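/- Fix integers m, n ≥ 1. (1) The subspace 𝒱^{ȷ,0}_{m|n,n} is invariant under every left operator B^L_i and B^L_{−i} (i ∈ {1/2, …, m−1/2}) and under the left Cartan operators d^L_0, d^L_r (r ∈ {1,…,m}). (2) The ℚ(q)-linear map Λ^ȷ : V^{⊗n} → 𝒱^{ȷ,0}_{m|n,n} determined by Λ^ȷ(v_λ) = t^{(A_λ)} for λ ∈ {−m,…,m}^n is a bijection. (3) Λ^ȷ intertwines the actions: Λ^ȷ(𝓑_i v) = B^L_i Λ^ȷ(v) and Λ^ȷ(𝓑_{−i} v) = B^L_{−i} Λ^ȷ(v) for every i ∈ {1/2,…,m−1/2}, and Λ^ȷ(𝓓_r v) = d^L_r Λ^ȷ(v) for every r ∈ {0,1,…,m}, for all v ∈ V^{⊗n}. (Thus the ı-weight ρ̄ space of the ȷ-type ıHowe duality module is isomorphic to V^{⊗n} as a module over the ıquantum group.) -/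

import Mathlib

open scoped BigOperators Classical

noncomputable section

/-- The base field `ℚ(q)`. -/
abbrev K : Type := RatFunc ℚ

/-- The indeterminate `q`. -/
def q : K := RatFunc.X

/-- The quantum integer `[r] = (q^r - q^{-r})/(q - q^{-1})`. -/
def qint (r : ℤ) : K := (q ^ r - q ^ (-r)) / (q - q⁻¹)

/-- The quantum factorial `[r]!`. -/
def qfac : ℕ → K
  | 0 => 1
  | n+1 => qfac n * qint (n+1)

/-- The index set `𝕀_N = {-(N-1)/2, -(N-3)/2, …, (N-1)/2}` as a finite set of rationals. -/
def II (N : ℕ) : Finset ℚ := (Finset.range N).image (fun k : ℕ => (k : ℚ) - ((N : ℚ) - 1) / 2)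

theorem II_neg {N : ℕ} {a : ℚ} (h : a ∈ II N) : -a ∈ II N := by
  obtain ⟨k, hk, hv⟩ := Finset.mem_image.mp h
  rw [Finset.mem_range] at hk
  refine Finset.mem_image.mpr ⟨N - 1 - k, Finset.mem_range.mpr (by omega), ?_⟩
  have h1 : ((N - 1 - k : ℕ) : ℚ) = (N : ℚ) - 1 - (k : ℚ) := by
    have h2 : (N : ℚ) = ((N - 1 - k : ℕ) : ℚ) + (k : ℚ) + 1 := by
      exact_mod_cast congrArg (Nat.cast : ℕ → ℚ) (by omega : N = (N - 1 - k) + k + 1)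
    linarith
  rw [h1, ← hv]; ring

/-- Matrices with rational row/column labels and natural number entries. -/
abbrev Mat : Type := ℚ → ℚ → ℕ

/-- The θ-elementary matrix `E^θ_{r,c} = E_{r,c} + E_{-r,-c}`. -/
def chiM (r c : ℚ) : Mat := fun x y =>
  (if x = r ∧ y = c then 1 else 0) + (if x = -r ∧ y = -c then 1 else 0)

/-- `A + E^θ_{p,j} - E^θ_{p',j'}` (truncated ℕ-subtraction; only used where the
corresponding q-integer coefficient vanishes otherwise). -/
def matMove (A : Mat) (p j p' j' : ℚ) : Mat := fun x y => A x y + chiM p j x y - chiM p' j' x y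

/-- Free `ℚ(q)`-vector space on the set of matrices `P`. -/
abbrev FM (P : Set Mat) : Type := {A : Mat // A ∈ P} →₀ K

/-- Basis vector `t^{(A)}` (zero if `A ∉ P`). -/
def tP (P : Set Mat) (A : Mat) : FM P := if h : A ∈ P then Finsupp.single ⟨A, h⟩ 1 else 0

/-- Linear operator on `FM P` defined by its values on basis vectors. -/
def opOf {P : Set Mat} (f : Mat → FM P) : FM P →ₗ[K] FM P :=
  Finsupp.lift (FM P) K {A : Mat // A ∈ P} fun A => f A.1

/-- The set `Ξ^j_{m|n,d}`: matrices supported on `{-m,…,m} × {-n,…,n}`, centro-symmetric,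
with total entry sum `2d+1`.  (Note `𝕀_{2m+1} = {-m,…,m}`.) -/
def Xij (m n d : ℕ) : Set Mat :=
  {A | (∀ i j, A i j ≠ 0 → i ∈ II (2*m+1) ∧ j ∈ II (2*n+1)) ∧
       (∀ i j, A i j = A (-i) (-j)) ∧
       ∑ i ∈ II (2*m+1), ∑ j ∈ II (2*n+1), A i j = 2*d+1}

/-- Left operator `B^L_i` (j-case), for half-integers `i ∈ {1/2,…,m-1/2}`. -/
def BLj (n : ℕ) (P : Set Mat) (i : ℚ) : FM P →ₗ[K] FM P :=
  opOf fun A =>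
    (∑ j ∈ (II (2*n+1)).filter (fun j => j ≤ 0),
      if (if i = 1/2 ∧ j = 0 then 1 else 0) < A (i-1/2) j then
        (q ^ ((∑ k ∈ (II (2*n+1)).filter (fun k => j ≤ k), ((A (i+1/2) k : ℤ) - (A (i-1/2) k : ℤ)))
              + 1 + (if i = 1/2 then 1 else 0))
          * qint ((A (i-1/2) j : ℤ) - (if i = 1/2 ∧ j = 0 then 1 else 0)))
          • tP P (matMove A (i+1/2) j (i-1/2) j)
      else 0)
    + (∑ j ∈ (II (2*n+1)).filter (fun j => 0 < j),
        (q ^ ((∑ k ∈ (II (2*n+1)).filter (fun k => j ≤ k), ((A (i+1/2) k : ℤ) - (A (i-1/2) k : ℤ))) + 1)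
          * qint (A (i-1/2) j)) • tP P (matMove A (i+1/2) j (i-1/2) j))

/-- Left operator `B^L_{-i}` (j-case), for half-integers `i ∈ {1/2,…,m-1/2}`. -/
def BLjn (n : ℕ) (P : Set Mat) (i : ℚ) : FM P →ₗ[K] FM P :=
  opOf fun A => ∑ j ∈ II (2*n+1),
    (q ^ ((∑ k ∈ (II (2*n+1)).filter (fun k => k ≤ j), ((A (i-1/2) k : ℤ) - (A (i+1/2) k : ℤ))) + 1)
      * qint (A (i+1/2) j)) • tP P (matMove A (i-1/2) j (i+1/2) j)

/-- Left Cartan operator `(d^L_0)^e`, `e = ±1` (j-case). -/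
def dL0j (n : ℕ) (P : Set Mat) (e : ℤ) : FM P →ₗ[K] FM P :=
  opOf fun A => (q ^ (e * (((∑ j ∈ II (2*n+1), (A 0 j : ℤ)) - 1) / 2))) • tP P A

/-- Left Cartan operator `(d^L_r)^e`, `r ∈ {1,…,m}`, `e = ±1` (j-case). -/
def dLj (n : ℕ) (P : Set Mat) (r : ℚ) (e : ℤ) : FM P →ₗ[K] FM P :=
  opOf fun A => (q ^ (e * ∑ j ∈ II (2*n+1), (A r j : ℤ))) • tP P A

/-- Right operator `B^R_i` (j-case), for half-integers `i ∈ {1/2,…,n-1/2}`. -/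
def BRj (m : ℕ) (P : Set Mat) (i : ℚ) : FM P →ₗ[K] FM P :=
  opOf fun A => ∑ j ∈ II (2*m+1),
    (q ^ (∑ k ∈ (II (2*m+1)).filter (fun k => j < k), ((A k (i+1/2) : ℤ) - (A k (i-1/2) : ℤ)))
      * qint (A j (i+1/2))) • tP P (matMove A j (i-1/2) j (i+1/2))

/-- Right operator `B^R_{-i}` (j-case), for half-integers `i ∈ {1/2,…,n-1/2}`. -/
def BRjn (m : ℕ) (P : Set Mat) (i : ℚ) : FM P →ₗ[K] FM P :=
  opOf fun A =>
    (∑ j ∈ (II (2*m+1)).filter (fun j => j ≤ 0),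
      if (if i = 1/2 ∧ j = 0 then 1 else 0) < A j (i-1/2) then
        (q ^ (∑ k ∈ (II (2*m+1)).filter (fun k => k < j), ((A k (i-1/2) : ℤ) - (A k (i+1/2) : ℤ)))
          * qint ((A j (i-1/2) : ℤ) - (if i = 1/2 ∧ j = 0 then 1 else 0)))
          • tP P (matMove A j (i+1/2) j (i-1/2))
      else 0)
    + (∑ j ∈ (II (2*m+1)).filter (fun j => 0 < j),
        (q ^ ((∑ k ∈ (II (2*m+1)).filter (fun k => k < j), ((A k (i-1/2) : ℤ) - (A k (i+1/2) : ℤ)))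
              - (if i = 1/2 then 1 else 0))
          * qint (A j (i-1/2))) • tP P (matMove A j (i+1/2) j (i-1/2)))

/-- Right Cartan operator `(d^R_r)^e`, `r ∈ {1,…,n}`, `e = ±1` (j-case). -/
def dRj (m : ℕ) (P : Set Mat) (r : ℚ) (e : ℤ) : FM P →ₗ[K] FM P :=
  opOf fun A => (q ^ (e * ∑ k ∈ II (2*m+1), (A k r : ℤ))) • tP P A

/-- Right Cartan operator `(d^R_0)^e`, `e = ±1` (j-case). -/
def dR0j (m : ℕ) (P : Set Mat) (e : ℤ) : FM P →ₗ[K] FM P :=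
  opOf fun A => (q ^ (e * (((∑ k ∈ II (2*m+1), (A k 0 : ℤ)) - 1) / 2))) • tP P A

/-- Basis index of `V`: elements of `𝕀_M`. -/
def SubI (M : ℕ) : Type := {a : ℚ // a ∈ II M}

/-- `V^{⊗n}`: free `ℚ(q)`-vector space on `n`-tuples from `𝕀_M`. -/
abbrev TV (n M : ℕ) : Type := (Fin n → SubI M) →₀ K

/-- Basis vector `v_λ`. -/
def tT {n M : ℕ} (l : Fin n → SubI M) : TV n M := Finsupp.single l 1

/-- A "single-target" operator on `V`: `v_a ↦ c a • v_{t a}`. -/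
structure SOp where
  t : ℚ → ℚ
  c : ℚ → K

def SOp.id' : SOp := ⟨fun a => a, fun _ => 1⟩
/-- Composite `O ∘ P`. -/
def SOp.comp (O P : SOp) : SOp := ⟨fun a => O.t (P.t a), fun a => P.c a * O.c (P.t a)⟩
/-- `E_i v_a = δ(a = i+1/2) v_{a-1}`. -/
def Eop (i : ℚ) : SOp := ⟨fun a => a - 1, fun a => if a = i + 1/2 then 1 else 0⟩
/-- `F_i v_a = δ(a = i-1/2) v_{a+1}`. -/
def Fop (i : ℚ) : SOp := ⟨fun a => a + 1, fun a => if a = i - 1/2 then 1 else 0⟩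
/-- A diagonal operator `v_a ↦ q^{f a} v_a`. -/
def diagOp (f : ℚ → ℤ) : SOp := ⟨fun a => a, fun a => q ^ f a⟩
/-- `K_i^{-1}` (diagonal). -/
def Kinv (i : ℚ) : SOp := diagOp fun a => (if a = i+1/2 then 1 else 0) - (if a = i-1/2 then 1 else 0)
/-- `K_i` (diagonal). -/
def Kpos (i : ℚ) : SOp := diagOp fun a => (if a = i-1/2 then 1 else 0) - (if a = i+1/2 then 1 else 0)
/-- `k_i^{-1} = K_i^{-1} K_{-i}`. -/
def kinv (i : ℚ) : SOp := (Kinv i).comp (Kpos (-i))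
/-- `k_i = K_i K_{-i}^{-1}`. -/
def kpos (i : ℚ) : SOp := (Kpos i).comp (Kinv (-i))
/-- `(D_r D_{-r})^e` (diagonal), `e = ±1`. -/
def DDop (r : ℚ) (e : ℤ) : SOp := diagOp fun a => e * ((if a = r then 1 else 0) + (if a = -r then 1 else 0))
/-- `D_0^e` (diagonal), `e = ±1`. -/
def D0op (e : ℤ) : SOp := diagOp fun a => e * (if a = 0 then 1 else 0)

/-- Tensor product `ops 0 ⊗ ops 1 ⊗ ⋯ ⊗ ops (n-1)` of single-target operators on `V^{⊗n}`. -/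
def tensorOp {n M : ℕ} (ops : Fin n → SOp) : TV n M →ₗ[K] TV n M :=
  Finsupp.lift (TV n M) K (Fin n → SubI M) fun l =>
    if h : ∀ r, (ops r).t (l r).1 ∈ II M then
      Finsupp.single (fun r => ⟨(ops r).t (l r).1, h r⟩) (∏ r, (ops r).c (l r).1)
    else 0

/-- `𝓑_i` on `V^{⊗n}`, for `i ≠ 0` (ı-case) resp. `i ∈ {1/2,…,m-1/2}` (ȷ-case). -/
def calB (n M : ℕ) (i : ℚ) : TV n M →ₗ[K] TV n M :=
  (∑ r : Fin n, tensorOp fun s => if s < r then SOp.id' else if s = r then Fop i else Kinv i)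
  + (∑ r : Fin n, tensorOp fun s => if s < r then kinv i else if s = r then (Eop (-i)).comp (Kinv i) else Kinv i)

/-- `𝓑_0` on `V^{⊗n}` (ı-case). -/
def calB0 (n M : ℕ) : TV n M →ₗ[K] TV n M :=
  (∑ r : Fin n, tensorOp fun s => if s < r then SOp.id' else if s = r then Fop 0 else Kinv 0)
  + q⁻¹ • (∑ r : Fin n, tensorOp fun s => if s < r then SOp.id' else if s = r then (Eop 0).comp (Kinv 0) else Kinv 0)
  + tensorOp fun _ => Kinv 0

/-- `𝓑_{-i}` on `V^{⊗n}` (ȷ-case), for `i ∈ {1/2,…,m-1/2}`. -/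
def calBn (n M : ℕ) (i : ℚ) : TV n M →ₗ[K] TV n M :=
  (∑ r : Fin n, tensorOp fun s => if s < r then SOp.id' else if s = r then Fop (-i) else Kinv (-i))
  + (∑ r : Fin n, tensorOp fun s => if s < r then kpos i else if s = r then (Kinv (-i)).comp (Eop i) else Kinv (-i))

/-- `𝓓_r^e = ((D_r D_{-r})^e)^{⊗n}`. -/
def calD (n M : ℕ) (r : ℚ) (e : ℤ) : TV n M →ₗ[K] TV n M := tensorOp fun _ => DDop r e

/-- `𝓓_0^e = (D_0^e)^{⊗n}`. -/
def calD0 (n M : ℕ) (e : ℤ) : TV n M →ₗ[K] TV n M := tensorOp fun _ => D0op e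

/-- Negation on `𝕀_M`. -/
def negS {M : ℕ} (a : SubI M) : SubI M := ⟨-a.1, II_neg a.2⟩

/-- `λ · s` where `s` interchanges the tensor positions `a` and `b`. -/
def swapL {n M : ℕ} (a b : Fin n) (l : Fin n → SubI M) : Fin n → SubI M := l ∘ Equiv.swap a b

/-- The Hecke operator `σ` acting in tensor positions `a, b` (for `a < b` adjacent). -/
def sigmaI {n M : ℕ} (a b : Fin n) : TV n M →ₗ[K] TV n M :=
  Finsupp.lift (TV n M) K (Fin n → SubI M) fun l =>
    if (l a).1 < (l b).1 then tT (swapL a b l)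
    else if (l a).1 = (l b).1 then q⁻¹ • tT l
    else tT (swapL a b l) + (q⁻¹ - q) • tT l

/-- The Hecke operator `σ_0`. -/
def sigma0 {n M : ℕ} (hn : 0 < n) : TV n M →ₗ[K] TV n M :=
  Finsupp.lift (TV n M) K (Fin n → SubI M) fun l =>
    if 0 < (l ⟨0, hn⟩).1 then tT (Function.update l ⟨0, hn⟩ (negS (l ⟨0, hn⟩)))
    else if (l ⟨0, hn⟩).1 = 0 then q⁻¹ • tT l
    else tT (Function.update l ⟨0, hn⟩ (negS (l ⟨0, hn⟩))) + (q⁻¹ - q) • tT l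

/-- `σ_i`, `0 ≤ i ≤ n-1` (for `i ≥ 1` it acts on the 1-based entries `λ_i, λ_{i+1}`). -/
def sigmaB {n M : ℕ} (hn : 0 < n) (i : ℕ) (hi : i < n) : TV n M →ₗ[K] TV n M :=
  if i = 0 then sigma0 hn else sigmaI ⟨i - 1, by omega⟩ ⟨i, hi⟩

/-- The subset `Ξ^{j,0}_{m|n,n}`. -/
def Xi0j (m n : ℕ) : Set Mat :=
  {A | A ∈ Xij m n n ∧ A 0 0 = 1 ∧
       ∀ j ∈ (II (2*n+1)).filter (fun j => 0 < j), ∑ i ∈ II (2*m+1), A i j = 1}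

/-- The ı-weight `ρ̄` subspace `𝒱^{j,0}_{m|n,n}`. -/
def V0j (m n : ℕ) : Submodule K (FM (Xij m n n)) :=
  Submodule.span K {v | ∃ A ∈ Xi0j m n, v = tP (Xij m n n) A}

/-- The 0-1 matrix `A_λ` (j-case): column `j` is `e_{λ_j}`, column `-j` is `e_{-λ_j}`
(`j = 1,…,n`; here `j : Fin n` is 0-based, so column `j + 1`), and column `0` is `e_0`. -/
def Aj {n : ℕ} (l : Fin n → ℚ) : Mat := fun x y =>
  (if x = 0 ∧ y = 0 then 1 else 0)
  + ∑ j : Fin n, ((if y = (j : ℚ) + 1 ∧ x = l j then 1 else 0)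
                + (if y = -((j : ℚ) + 1) ∧ x = -(l j) then 1 else 0))

/-- The linear map `Λ^j : V^{⊗n} → 𝒱^j_{m|n,n}`, `v_λ ↦ t^{(A_λ)}`. -/
def Lamj (m n : ℕ) : TV n (2*m+1) →ₗ[K] FM (Xij m n n) :=
  Finsupp.lift (FM (Xij m n n)) K (Fin n → SubI (2*m+1)) fun l =>
    tP (Xij m n n) (Aj fun r => (l r).1)

theorem q_ne_zero : q ≠ 0 := RatFunc.X_ne_zero

theorem q_sub_inv_ne_zero : q - q⁻¹ ≠ 0 := by
  intro h
  have h1 : q * q = 1 := by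
    have := congrArg (· * q) h
    simpa [sub_mul, sub_eq_zero, q_ne_zero] using this
  have h2 : (Polynomial.X * Polynomial.X : Polynomial ℚ) = 1 := by
    apply RatFunc.algebraMap_injective ℚ
    simpa [q] using h1
  simpa using congrArg (Polynomial.eval 0) h2

theorem qint_zero : qint 0 = 0 := by simp [qint]

theorem qint_one : qint 1 = 1 := by
  simp [qint, div_self q_sub_inv_ne_zero]

theorem q_zpow_sum {ι : Type*} (s : Finset ι) (f : ι → ℤ) :
    q ^ (∑ i ∈ s, f i) = ∏ i ∈ s, q ^ f i := by
  induction s using Finset.induction_on with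
  | empty => simp
  | insert a s ha ih => rw [Finset.sum_insert ha, Finset.prod_insert ha, zpow_add₀ q_ne_zero, ih]

section IndexSets

theorem sum_II_odd {β : Type*} [AddCommMonoid β] (n : ℕ) (f : ℚ → β) :
    ∑ j ∈ II (2*n+1), f j = f 0 + ∑ s : Fin n, (f ((s : ℚ) + 1) + f (-((s : ℚ) + 1))) := by
  have hinj : Set.InjOn (fun k : ℕ => (k : ℚ) - (((2*n+1 : ℕ) : ℚ) - 1) / 2)
      (Finset.range (2*n+1)) := by
    intro a _ b _ h
    simpa using h
  rw [II, Finset.sum_image hinj, show 2*n+1 = n + (n+1) by ring, Finset.sum_range_add,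
    Finset.sum_range_succ', ← Finset.sum_range_reflect, Fin.sum_univ_eq_sum_range
      (fun s => f ((s : ℚ) + 1) + f (-((s : ℚ) + 1))), Finset.sum_add_distrib]
  have h1 : ∀ k ∈ Finset.range n,
      f (((n - 1 - k : ℕ) : ℚ) - (((n + (n+1) : ℕ) : ℚ) - 1) / 2) = f (-((k : ℚ) + 1)) := by
    intro k hk
    rw [Finset.mem_range] at hk
    congr 1
    rw [Nat.sub_sub, Nat.cast_sub (by omega)]
    push_cast
    ring
  rw [Finset.sum_congr rfl h1]
  have h2 : ∀ k ∈ Finset.range n,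
      f (((n + (k + 1) : ℕ) : ℚ) - (((n + (n+1) : ℕ) : ℚ) - 1) / 2) = f ((k : ℚ) + 1) := by
    intro k _
    congr 1
    push_cast
    ring
  rw [Finset.sum_congr rfl h2]
  have h3 : f (((n + 0 : ℕ) : ℚ) - (((n + (n+1) : ℕ) : ℚ) - 1) / 2) = f 0 := by
    congr 1
    push_cast
    ring
  rw [h3, add_comm, add_assoc, add_comm, add_comm (f 0), add_assoc]
  abel

theorem mem_II_odd {n : ℕ} {y : ℚ} :
    y ∈ II (2*n+1) ↔ y = 0 ∨ ∃ s : Fin n, y = (s : ℚ) + 1 ∨ y = -((s : ℚ) + 1) := by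
  rw [II, Finset.mem_image]
  constructor
  · rintro ⟨k, hk, rfl⟩
    rw [Finset.mem_range] at hk
    rcases lt_trichotomy k n with h | h | h
    · refine Or.inr ⟨⟨n - 1 - k, by omega⟩, Or.inr ?_⟩
      simp only [Nat.sub_sub]
      rw [Nat.cast_sub (by omega)]
      push_cast
      ring
    · left
      subst h
      push_cast
      ring
    · refine Or.inr ⟨⟨k - n - 1, by omega⟩, Or.inl ?_⟩
      simp only [Nat.sub_sub]
      rw [Nat.cast_sub (by omega)]
      push_cast
      ring
  · rintro (rfl | ⟨s, rfl | rfl⟩)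
    · exact ⟨n, by simp; omega, by push_cast; ring⟩
    · exact ⟨n + s + 1, by simp; omega, by push_cast; ring⟩
    · refine ⟨n - (s + 1), by simp; omega, ?_⟩
      rw [Nat.cast_sub (by omega)]
      push_cast
      ring

theorem zero_mem_II_odd (n : ℕ) : (0 : ℚ) ∈ II (2*n+1) := mem_II_odd.2 (Or.inl rfl)

theorem pos_mem_II_odd {n : ℕ} (s : Fin n) : (s : ℚ) + 1 ∈ II (2*n+1) :=
  mem_II_odd.2 (Or.inr ⟨s, Or.inl rfl⟩)

theorem neg_mem_II_odd {n : ℕ} (s : Fin n) : -((s : ℚ) + 1) ∈ II (2*n+1) :=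
  mem_II_odd.2 (Or.inr ⟨s, Or.inr rfl⟩)

theorem Fin.cast_add_one_pos {n : ℕ} (s : Fin n) : (0 : ℚ) < (s : ℚ) + 1 := by positivity

theorem Fin.cast_add_one_inj {n : ℕ} {s r : Fin n} : (s : ℚ) + 1 = (r : ℚ) + 1 ↔ s = r := by
  rw [add_left_inj, Nat.cast_inj, Fin.ext_iff]

theorem Fin.cast_add_one_le {n : ℕ} {s r : Fin n} : (s : ℚ) + 1 ≤ (r : ℚ) + 1 ↔ s ≤ r := by
  rw [add_le_add_iff_right, Nat.cast_le, Fin.le_def]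

end IndexSets

section Matrices

variable {n : ℕ}

theorem chiM_neg (r c : ℚ) : chiM (-r) (-c) = chiM r c := by
  funext x y
  simp only [chiM, neg_neg]
  exact add_comm _ _

theorem Aj_apply_zero (l : Fin n → ℚ) (x : ℚ) : Aj l x 0 = if x = 0 then 1 else 0 := by
  have h (s : Fin n) := Fin.cast_add_one_pos s
  have h1 : ∀ s : Fin n, ¬ (0 : ℚ) = (s : ℚ) + 1 := fun s => (h s).ne
  have h2 : ∀ s : Fin n, ¬ (0 : ℚ) = -((s : ℚ) + 1) := fun s e => by linarith [h s]
  simp only [Aj, h1, h2, false_and, if_false, and_true, add_zero, Finset.sum_const_zero]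

theorem Aj_apply_pos (l : Fin n → ℚ) (x : ℚ) (r : Fin n) :
    Aj l x ((r : ℚ) + 1) = if x = l r then 1 else 0 := by
  have h (s : Fin n) := Fin.cast_add_one_pos s
  have h1 : ¬ (r : ℚ) + 1 = 0 := (h r).ne'
  have h2 : ∀ s : Fin n, ¬ (r : ℚ) + 1 = -((s : ℚ) + 1) := fun s e => by linarith [h s, h r]
  simp only [Aj, h1, h2, false_and, and_false, if_false, add_zero, zero_add,
    Fin.cast_add_one_inj, ite_and, Finset.sum_ite_eq, Finset.mem_univ, if_true]

theorem Aj_neg (l : Fin n → ℚ) (x y : ℚ) : Aj l (-x) (-y) = Aj l x y := by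
  simp only [Aj, neg_eq_zero, neg_inj]
  congr 1
  refine Finset.sum_congr rfl fun s _ => ?_
  rw [add_comm]
  simp only [neg_eq_iff_eq_neg]

theorem Aj_apply_neg (l : Fin n → ℚ) (x : ℚ) (r : Fin n) :
    Aj l x (-((r : ℚ) + 1)) = if x = -l r then 1 else 0 := by
  rw [← Aj_neg, neg_neg, Aj_apply_pos]
  simp only [neg_eq_iff_eq_neg]

theorem Aj_ne_zero {l : Fin n → ℚ} {x y : ℚ} (h : Aj l x y ≠ 0) :
    (x = 0 ∧ y = 0) ∨ ∃ s : Fin n, (y = (s : ℚ) + 1 ∧ x = l s) ∨ (y = -((s : ℚ) + 1) ∧ x = -l s) := by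
  by_contra! hc
  obtain ⟨h0, h1⟩ := hc
  refine h ?_
  have e0 : ¬ (x = 0 ∧ y = 0) := fun e => h0 e.1 e.2
  rw [Aj, if_neg e0, zero_add]
  refine Finset.sum_eq_zero fun s _ => ?_
  rw [if_neg fun e => (h1 s).1 e.1 e.2, if_neg fun e => (h1 s).2 e.1 e.2, add_zero]

theorem Aj_injective : Function.Injective (Aj : (Fin n → ℚ) → Mat) := by
  intro l l' h
  funext r
  have := congrFun (congrFun h (l r)) ((r : ℚ) + 1)
  rw [Aj_apply_pos, Aj_apply_pos, if_pos rfl] at this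
  by_contra hne
  rw [if_neg hne] at this
  exact one_ne_zero this

theorem Aj_update (l : Fin n → ℚ) (r : Fin n) (p x y : ℚ) :
    Aj (Function.update l r p) x y + chiM (l r) ((r : ℚ) + 1) x y
      = Aj l x y + chiM p ((r : ℚ) + 1) x y := by
  simp only [Aj, chiM]
  rw [← Finset.add_sum_erase _ _ (Finset.mem_univ r),
    ← Finset.add_sum_erase (Finset.univ : Finset (Fin n)) _ (Finset.mem_univ r)]
  have : ∀ s ∈ Finset.univ.erase r, Function.update l r p s = l s := fun s hs =>
    Function.update_of_ne (Finset.ne_of_mem_erase hs) _ _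
  rw [Finset.sum_congr rfl fun s hs => by rw [this s hs]]
  simp only [Function.update_self, and_comm]
  ring

theorem matMove_Aj_pos (l : Fin n → ℚ) (r : Fin n) (p : ℚ) :
    matMove (Aj l) p ((r : ℚ) + 1) (l r) ((r : ℚ) + 1) = Aj (Function.update l r p) := by
  funext x y
  rw [matMove, ← Aj_update, Nat.add_sub_cancel]

theorem matMove_Aj_neg (l : Fin n → ℚ) (r : Fin n) (p : ℚ) :
    matMove (Aj l) (-p) (-((r : ℚ) + 1)) (-l r) (-((r : ℚ) + 1))
      = Aj (Function.update l r p) := by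
  rw [← matMove_Aj_pos]
  funext x y
  simp only [matMove, chiM_neg]

theorem sum_column_Aj_pos {m : ℕ} {l : Fin n → ℚ} (hl : ∀ r, l r ∈ II (2*m+1)) (r : Fin n) :
    ∑ x ∈ II (2*m+1), Aj l x ((r : ℚ) + 1) = 1 := by
  simp only [Aj_apply_pos, Finset.sum_ite_eq', hl, if_true]

theorem sum_column_Aj_neg {m : ℕ} {l : Fin n → ℚ} (hl : ∀ r, l r ∈ II (2*m+1)) (r : Fin n) :
    ∑ x ∈ II (2*m+1), Aj l x (-((r : ℚ) + 1)) = 1 := by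
  simp only [Aj_apply_neg, Finset.sum_ite_eq', II_neg (hl r), if_true]

theorem Aj_mem_Xij {m : ℕ} {l : Fin n → ℚ} (hl : ∀ r, l r ∈ II (2*m+1)) :
    Aj l ∈ Xij m n n := by
  refine ⟨fun x y h => ?_, fun x y => (Aj_neg l x y).symm, ?_⟩
  · rcases Aj_ne_zero h with ⟨rfl, rfl⟩ | ⟨s, ⟨rfl, rfl⟩ | ⟨rfl, rfl⟩⟩
    · exact ⟨zero_mem_II_odd m, zero_mem_II_odd n⟩
    · exact ⟨hl s, pos_mem_II_odd s⟩
    · exact ⟨II_neg (hl s), neg_mem_II_odd s⟩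
  · rw [Finset.sum_comm, sum_II_odd]
    simp only [sum_column_Aj_pos hl, sum_column_Aj_neg hl, Aj_apply_zero, Finset.sum_ite_eq',
      zero_mem_II_odd, if_true, Finset.sum_const, Finset.card_univ, Fintype.card_fin, smul_eq_mul]
    ring

theorem mem_of_Aj_mem_Xij {m : ℕ} {l : Fin n → ℚ} (h : Aj l ∈ Xij m n n) (r : Fin n) :
    l r ∈ II (2*m+1) := by
  refine (h.1 (l r) ((r : ℚ) + 1) ?_).1
  rw [Aj_apply_pos, if_pos rfl]
  exact one_ne_zero

theorem Aj_mem_Xi0j {m : ℕ} {l : Fin n → ℚ} (hl : ∀ r, l r ∈ II (2*m+1)) :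
    Aj l ∈ Xi0j m n := by
  refine ⟨Aj_mem_Xij hl, by simp [Aj_apply_zero], fun j hj => ?_⟩
  rw [Finset.mem_filter, mem_II_odd] at hj
  obtain ⟨rfl | ⟨s, rfl | rfl⟩, hpos⟩ := hj
  · exact absurd hpos (lt_irrefl _)
  · exact sum_column_Aj_pos hl s
  · linarith [Fin.cast_add_one_pos s]

theorem exists_unit_of_sum_eq_one {ι : Type*} [DecidableEq ι] {s : Finset ι} {f : ι → ℕ}
    (h : ∑ i ∈ s, f i = 1) : ∃ a ∈ s, ∀ i ∈ s, f i = if i = a then 1 else 0 := by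
  obtain ⟨a, ha, hne⟩ : ∃ a ∈ s, f a ≠ 0 := by
    by_contra! hc
    rw [Finset.sum_eq_zero hc] at h
    exact zero_ne_one h
  refine ⟨a, ha, fun i hi => ?_⟩
  rw [← Finset.add_sum_erase _ _ ha] at h
  split_ifs with hia
  · subst hia
    omega
  · have : f i ≤ ∑ x ∈ s.erase a, f x :=
      Finset.single_le_sum (f := f) (fun _ _ => Nat.zero_le _) (Finset.mem_erase.2 ⟨hia, hi⟩)
    omega

theorem exists_eq_Aj_of_mem_Xi0j {m : ℕ} {A : Mat} (hA : A ∈ Xi0j m n) :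
    ∃ l : Fin n → SubI (2*m+1), A = Aj fun r => (l r).1 := by
  obtain ⟨⟨hsupp, hsymm, htot⟩, h00, hcol⟩ := hA
  have hcol' (s : Fin n) : ∑ i ∈ II (2*m+1), A i ((s : ℚ) + 1) = 1 :=
    hcol _ (Finset.mem_filter.2 ⟨pos_mem_II_odd s, Fin.cast_add_one_pos s⟩)
  have hcolneg (s : Fin n) : ∑ i ∈ II (2*m+1), A i (-((s : ℚ) + 1)) = 1 := by
    refine Eq.trans ?_ (hcol' s)
    refine Finset.sum_nbij' (fun x => -x) (fun x => -x) (fun _ => II_neg) (fun _ => II_neg)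
      (fun _ _ => neg_neg _) (fun _ _ => neg_neg _) fun x _ => ?_
    rw [hsymm, neg_neg]
  have hcol0 : ∑ i ∈ II (2*m+1), A i 0 = 1 := by
    rw [Finset.sum_comm, sum_II_odd] at htot
    simp only [hcol', hcolneg, Finset.sum_const, Finset.card_univ, Fintype.card_fin,
      smul_eq_mul] at htot
    omega
  have hzero {x y : ℚ} (h : ¬ (x ∈ II (2*m+1) ∧ y ∈ II (2*n+1))) : A x y = 0 := by
    by_contra hne
    exact h (hsupp x y hne)
  choose l hl hlA using fun s => exists_unit_of_sum_eq_one (hcol' s)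
  have hpos (x : ℚ) (s : Fin n) : A x ((s : ℚ) + 1) = if x = l s then 1 else 0 := by
    by_cases hx : x ∈ II (2*m+1)
    · exact hlA s x hx
    · rw [hzero fun h => hx h.1, if_neg fun h : x = l s => hx (h ▸ hl s)]
  refine ⟨fun s => ⟨l s, hl s⟩, ?_⟩
  funext x y
  by_cases hy : y ∈ II (2*n+1)
  · obtain rfl | ⟨s, rfl | rfl⟩ := mem_II_odd.1 hy
    · rw [Aj_apply_zero]
      obtain ⟨a, -, haA⟩ := exists_unit_of_sum_eq_one hcol0
      have ha : 0 = a := by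
        have := haA 0 (zero_mem_II_odd m)
        by_contra hne
        rw [if_neg hne, h00] at this
        exact one_ne_zero this
      subst ha
      by_cases hx : x ∈ II (2*m+1)
      · exact haA x hx
      · rw [hzero fun h => hx h.1, if_neg fun h : x = 0 => hx (h ▸ zero_mem_II_odd m)]
    · rw [Aj_apply_pos, hpos]
    · rw [Aj_apply_neg, hsymm, neg_neg, hpos]
      simp only [neg_eq_iff_eq_neg]
  · rw [hzero fun h => hy h.2]
    by_contra hne
    exact hy ((Aj_mem_Xij (m := m) (l := l) hl).1 x y (Ne.symm hne)).2

end Matrices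

section Operators

variable {m n : ℕ}

theorem Finsupp.lift_single {ι W : Type*} [AddCommGroup W] [Module K W] (f : ι → W) (a : ι) (c : K) :
    Finsupp.lift W K ι f (Finsupp.single a c) = c • f a := by
  simp

theorem opOf_tP {P : Set Mat} (f : Mat → FM P) {A : Mat} (hA : A ∈ P) :
    opOf f (tP P A) = f A := by
  rw [opOf, tP, dif_pos hA, Finsupp.lift_single, one_smul]

theorem Lamj_tT (l : Fin n → SubI (2*m+1)) :
    Lamj m n (tT l) = tP (Xij m n n) (Aj fun r => (l r).1) :=
  (Finsupp.lift_single _ _ _).trans (one_smul _ _)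

theorem Lamj_tensorOp_tT (ops : Fin n → SOp) (l : Fin n → SubI (2*m+1)) :
    Lamj m n (tensorOp ops (tT l)) =
      (∏ r, (ops r).c (l r).1) • tP (Xij m n n) (Aj fun r => (ops r).t (l r).1) := by
  rw [tensorOp, tT, Finsupp.lift_single, one_smul]
  split_ifs with h
  · exact Finsupp.lift_single _ _ _
  · rw [map_zero, tP, dif_neg fun hA => h (mem_of_Aj_mem_Xij hA), smul_zero]

theorem linearMap_eq_of_tT {M : ℕ} {W : Type*} [AddCommGroup W] [Module K W]
    {f g : TV n M →ₗ[K] W} (h : ∀ l, f (tT l) = g (tT l)) (v : TV n M) : f v = g v := by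
  refine LinearMap.congr_fun (Finsupp.lhom_ext fun l c => ?_) v
  have : (Finsupp.single l c : TV n M) = c • tT l := by simp [tT]
  rw [this, map_smul, map_smul, h]

theorem Lamj_injective : Function.Injective (Lamj m n) := by
  let e : (Fin n → SubI (2*m+1)) → {A : Mat // A ∈ Xij m n n} := fun l =>
    ⟨Aj fun r => (l r).1, Aj_mem_Xij fun r => (l r).2⟩
  have he : Function.Injective e := by
    intro l l' h
    funext r
    exact Subtype.ext (congrFun (Aj_injective (congrArg Subtype.val h)) r)
  have : ∀ v, Lamj m n v = Finsupp.lmapDomain K K e v := by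
    refine linearMap_eq_of_tT fun l => ?_
    rw [Lamj_tT, tT, Finsupp.lmapDomain_apply, Finsupp.mapDomain_single, tP, dif_pos]
  intro v w h
  rw [this, this] at h
  exact Finsupp.mapDomain_injective he h

theorem range_Lamj : LinearMap.range (Lamj m n) = V0j m n := by
  apply le_antisymm
  · rintro _ ⟨v, rfl⟩
    induction v using Finsupp.induction_linear with
    | zero => simp
    | add v w hv hw => rw [map_add]; exact add_mem hv hw
    | single l c =>
      have : (Finsupp.single l c : TV n (2*m+1)) = c • tT l := by simp [tT]
      rw [this, map_smul, Lamj_tT]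
      exact Submodule.smul_mem _ _
        (Submodule.subset_span ⟨_, Aj_mem_Xi0j fun r => (l r).2, rfl⟩)
  · refine Submodule.span_le.2 ?_
    rintro _ ⟨A, hA, rfl⟩
    obtain ⟨l, rfl⟩ := exists_eq_Aj_of_mem_Xi0j hA
    exact ⟨tT l, Lamj_tT l⟩

theorem map_mem_V0j_of_intertwines {f : TV n (2*m+1) →ₗ[K] TV n (2*m+1)}
    {g : FM (Xij m n n) →ₗ[K] FM (Xij m n n)} (h : ∀ v, Lamj m n (f v) = g (Lamj m n v))
    {v : FM (Xij m n n)} (hv : v ∈ V0j m n) : g v ∈ V0j m n := by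
  rw [← range_Lamj] at hv ⊢
  obtain ⟨w, rfl⟩ := hv
  exact ⟨f w, h w⟩

end Operators

section FilteredSums

variable {β : Type*} [AddCommMonoid β] {n : ℕ}

theorem sum_II_odd_nonpos (f : ℚ → β) :
    ∑ j ∈ (II (2*n+1)).filter (fun j => j ≤ 0), f j = f 0 + ∑ s : Fin n, f (-((s : ℚ) + 1)) := by
  have h (s : Fin n) := Fin.cast_add_one_pos s
  rw [Finset.sum_filter, sum_II_odd, if_pos le_rfl]
  congr 1
  refine Finset.sum_congr rfl fun s _ => ?_
  rw [if_neg (h s).not_ge, if_pos (by linarith [h s]), zero_add]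

theorem sum_II_odd_pos (f : ℚ → β) :
    ∑ j ∈ (II (2*n+1)).filter (fun j => 0 < j), f j = ∑ s : Fin n, f ((s : ℚ) + 1) := by
  have h (s : Fin n) := Fin.cast_add_one_pos s
  rw [Finset.sum_filter, sum_II_odd, if_neg (lt_irrefl _), zero_add]
  refine Finset.sum_congr rfl fun s _ => ?_
  rw [if_pos (h s), if_neg (by linarith [h s]), add_zero]

theorem sum_II_odd_ge_pos (r : Fin n) (f : ℚ → β) :
    ∑ k ∈ (II (2*n+1)).filter (fun k => (r : ℚ) + 1 ≤ k), f k
      = ∑ s : Fin n, if r ≤ s then f ((s : ℚ) + 1) else 0 := by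
  have h (s : Fin n) := Fin.cast_add_one_pos s
  rw [Finset.sum_filter, sum_II_odd, if_neg (h r).not_ge, zero_add]
  refine Finset.sum_congr rfl fun s _ => ?_
  rw [if_neg (by linarith [h s, h r] : ¬ (r : ℚ) + 1 ≤ -((s : ℚ) + 1)), add_zero]
  simp only [Fin.cast_add_one_le]

theorem sum_II_odd_ge_neg (r : Fin n) (f : ℚ → β) :
    ∑ k ∈ (II (2*n+1)).filter (fun k => -((r : ℚ) + 1) ≤ k), f k
      = f 0 + ∑ s : Fin n, (f ((s : ℚ) + 1) + if s ≤ r then f (-((s : ℚ) + 1)) else 0) := by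
  have h (s : Fin n) := Fin.cast_add_one_pos s
  rw [Finset.sum_filter, sum_II_odd, if_pos (by linarith [h r])]
  congr 1
  refine Finset.sum_congr rfl fun s _ => ?_
  rw [if_pos (by linarith [h s, h r] : -((r : ℚ) + 1) ≤ (s : ℚ) + 1)]
  simp only [neg_le_neg_iff, Fin.cast_add_one_le]

theorem sum_II_odd_le_pos (r : Fin n) (f : ℚ → β) :
    ∑ k ∈ (II (2*n+1)).filter (fun k => k ≤ (r : ℚ) + 1), f k
      = f 0 + ∑ s : Fin n, ((if s ≤ r then f ((s : ℚ) + 1) else 0) + f (-((s : ℚ) + 1))) := by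
  have h (s : Fin n) := Fin.cast_add_one_pos s
  rw [Finset.sum_filter, sum_II_odd, if_pos (h r).le]
  congr 1
  refine Finset.sum_congr rfl fun s _ => ?_
  rw [if_pos (by linarith [h s, h r] : -((s : ℚ) + 1) ≤ (r : ℚ) + 1)]
  simp only [Fin.cast_add_one_le]

theorem sum_II_odd_le_neg (r : Fin n) (f : ℚ → β) :
    ∑ k ∈ (II (2*n+1)).filter (fun k => k ≤ -((r : ℚ) + 1)), f k
      = ∑ s : Fin n, if r ≤ s then f (-((s : ℚ) + 1)) else 0 := by
  have h (s : Fin n) := Fin.cast_add_one_pos s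
  rw [Finset.sum_filter, sum_II_odd, if_neg (by linarith [h r]), zero_add]
  refine Finset.sum_congr rfl fun s _ => ?_
  rw [if_neg (by linarith [h s, h r] : ¬ (s : ℚ) + 1 ≤ -((r : ℚ) + 1)), zero_add]
  simp only [neg_le_neg_iff, Fin.cast_add_one_le]

theorem sum_add_eq_sum_of_ne {ι : Type*} [Fintype ι] {f g : ι → ℤ} {c : ℤ} (r : ι)
    (h : ∀ s, s ≠ r → f s = g s) (hr : f r + c = g r) : ∑ s, f s + c = ∑ s, g s := by
  rw [← Finset.add_sum_erase _ f (Finset.mem_univ r),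
    ← Finset.add_sum_erase _ g (Finset.mem_univ r), ← hr,
    Finset.sum_congr rfl fun s hs => h s (Finset.ne_of_mem_erase hs)]
  ring

end FilteredSums

section Intertwining

variable {m n : ℕ}

theorem Kinv_c_eq (l : Fin n → ℚ) (i : ℚ) (s : Fin n) :
    (Kinv i).c (l s) =
      q ^ ((Aj l (i+1/2) ((s : ℚ) + 1) : ℤ) - (Aj l (i-1/2) ((s : ℚ) + 1) : ℤ)) := by
  simp only [Kinv, diagOp, Aj_apply_pos, Nat.cast_ite, Nat.cast_one, Nat.cast_zero,
    eq_comm (b := l s)]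

theorem Kpos_c_eq (l : Fin n → ℚ) (i : ℚ) (s : Fin n) :
    (Kpos i).c (l s) =
      q ^ ((Aj l (i-1/2) ((s : ℚ) + 1) : ℤ) - (Aj l (i+1/2) ((s : ℚ) + 1) : ℤ)) := by
  simp only [Kpos, diagOp, Aj_apply_pos, Nat.cast_ite, Nat.cast_one, Nat.cast_zero,
    eq_comm (b := l s)]

theorem Kinv_neg_c_eq (l : Fin n → ℚ) (i : ℚ) (s : Fin n) :
    (Kinv (-i)).c (l s) =
      q ^ ((Aj l (i-1/2) (-((s : ℚ) + 1)) : ℤ) - (Aj l (i+1/2) (-((s : ℚ) + 1)) : ℤ)) := by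
  rw [Kinv_c_eq, ← Aj_neg l (i-1/2), ← Aj_neg l (i+1/2), neg_neg, neg_sub', neg_add',
    sub_neg_eq_add]

theorem Kpos_neg_c_eq (l : Fin n → ℚ) (i : ℚ) (s : Fin n) :
    (Kpos (-i)).c (l s) =
      q ^ ((Aj l (i+1/2) (-((s : ℚ) + 1)) : ℤ) - (Aj l (i-1/2) (-((s : ℚ) + 1)) : ℤ)) := by
  rw [Kpos_c_eq, ← Aj_neg l (i-1/2), ← Aj_neg l (i+1/2), neg_neg, neg_sub', neg_add',
    sub_neg_eq_add]

theorem Lamj_tensorOp_tT_of_zpow {ops : Fin n → SOp} {l : Fin n → SubI (2*m+1)} {r : Fin n}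
    {p : ℚ} {e : Fin n → ℤ} (hc : ∀ s, (ops s).c (l s).1 = q ^ e s)
    (hr : (ops r).t (l r).1 = p) (ht : ∀ s, s ≠ r → (ops s).t (l s).1 = (l s).1) :
    Lamj m n (tensorOp ops (tT l)) =
      q ^ (∑ s, e s) • tP (Xij m n n) (Aj (Function.update (fun s => (l s).1) r p)) := by
  have : (fun s => (ops s).t (l s).1) = Function.update (fun s => (l s).1) r p := by
    funext s
    by_cases hs : s = r
    · subst hs
      rw [hr, Function.update_self]
    · rw [ht s hs, Function.update_of_ne hs]
  rw [Lamj_tensorOp_tT, q_zpow_sum, this, Finset.prod_congr rfl fun s _ => hc s]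

theorem Lamj_tensorOp_tT_of_zero {ops : Fin n → SOp} {l : Fin n → SubI (2*m+1)} (r : Fin n)
    (hr : (ops r).c (l r).1 = 0) : Lamj m n (tensorOp ops (tT l)) = 0 := by
  rw [Lamj_tensorOp_tT, Finset.prod_eq_zero (Finset.mem_univ r) hr, zero_smul]

theorem Lamj_F_term {i : ℚ} (l : Fin n → SubI (2*m+1)) (r : Fin n) :
    Lamj m n (tensorOp (fun s => if s < r then SOp.id' else if s = r then Fop i else Kinv i)
        (tT l)) =
      (q ^ ((∑ k ∈ (II (2*n+1)).filter (fun k => (r : ℚ) + 1 ≤ k),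
          ((Aj (fun s => (l s).1) (i+1/2) k : ℤ) - (Aj (fun s => (l s).1) (i-1/2) k : ℤ))) + 1)
        * qint (Aj (fun s => (l s).1) (i-1/2) ((r : ℚ) + 1))) •
        tP (Xij m n n) (matMove (Aj fun s => (l s).1) (i+1/2) ((r : ℚ) + 1)
          (i-1/2) ((r : ℚ) + 1)) := by
  set L : Fin n → ℚ := fun s => (l s).1 with hL
  by_cases hr : i - 1/2 = L r
  · rw [Lamj_tensorOp_tT_of_zpow (r := r) (p := i + 1/2)
      (e := fun s => if r < s then
        (Aj L (i+1/2) ((s : ℚ) + 1) : ℤ) - (Aj L (i-1/2) ((s : ℚ) + 1) : ℤ) else 0)]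
    · rw [Aj_apply_pos, if_pos hr, Nat.cast_one, qint_one, mul_one, sum_II_odd_ge_pos,
        sum_add_eq_sum_of_ne r (g := fun s => if r < s then
        (Aj L (i+1/2) ((s : ℚ) + 1) : ℤ) - (Aj L (i-1/2) ((s : ℚ) + 1) : ℤ) else 0)]
      · rw [hr, matMove_Aj_pos]
      · intro s hs
        simp only [hs.symm.le_iff_lt]
      · rw [if_pos le_rfl, if_neg (lt_irrefl r), Aj_apply_pos, Aj_apply_pos, if_pos hr,
          if_neg (by linarith)]
        norm_num
    · intro s
      rcases lt_trichotomy s r with h | rfl | h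
      · simp [h, h.not_gt, SOp.id']
      · simp only [lt_irrefl, if_true, if_false, Fop, zpow_zero]
        exact if_pos hr.symm
      · rw [if_neg h.not_gt, if_neg h.ne', if_pos h]
        exact Kinv_c_eq L i s
    · simp only [lt_irrefl, if_true, if_false, Fop]
      change L r + 1 = _
      rw [← hr]
      ring
    · intro s hs
      rcases hs.lt_or_gt with h | h
      · simp [h, SOp.id']
      · rw [if_neg h.not_gt, if_neg h.ne']
        rfl
  · rw [Lamj_tensorOp_tT_of_zero r, Aj_apply_pos, if_neg hr, Nat.cast_zero, qint_zero, mul_zero,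
      zero_smul]
    simp only [lt_irrefl, if_true, if_false, Fop]
    exact if_neg fun h => hr h.symm

theorem SOp.comp_c (O P : SOp) (a : ℚ) : (O.comp P).c a = P.c a * O.c (P.t a) := rfl

theorem Eop_c_self {i a : ℚ} (h : a = i + 1/2) : (Eop i).c a = 1 := if_pos h

theorem Eop_c_of_ne {i a : ℚ} (h : ¬ a = i + 1/2) : (Eop i).c a = 0 := if_neg h

theorem kinv_c_eq (l : Fin n → ℚ) (i : ℚ) (s : Fin n) :
    (kinv i).c (l s) =
      q ^ (((Aj l (i+1/2) ((s : ℚ) + 1) : ℤ) - (Aj l (i-1/2) ((s : ℚ) + 1) : ℤ)) +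
        ((Aj l (i+1/2) (-((s : ℚ) + 1)) : ℤ) - (Aj l (i-1/2) (-((s : ℚ) + 1)) : ℤ))) := by
  rw [zpow_add₀ q_ne_zero, ← Kinv_c_eq, ← Kpos_neg_c_eq, mul_comm]
  rfl

theorem kpos_c_eq (l : Fin n → ℚ) (i : ℚ) (s : Fin n) :
    (kpos i).c (l s) =
      q ^ (((Aj l (i-1/2) ((s : ℚ) + 1) : ℤ) - (Aj l (i+1/2) ((s : ℚ) + 1) : ℤ)) +
        ((Aj l (i-1/2) (-((s : ℚ) + 1)) : ℤ) - (Aj l (i+1/2) (-((s : ℚ) + 1)) : ℤ))) := by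
  rw [zpow_add₀ q_ne_zero, ← Kpos_c_eq, ← Kinv_neg_c_eq, mul_comm]
  rfl

theorem Lamj_F_neg_term {i : ℚ} (l : Fin n → SubI (2*m+1)) (r : Fin n) :
    Lamj m n (tensorOp
        (fun s => if s < r then SOp.id' else if s = r then Fop (-i) else Kinv (-i)) (tT l)) =
      (q ^ ((∑ k ∈ (II (2*n+1)).filter (fun k => k ≤ -((r : ℚ) + 1)),
          ((Aj (fun s => (l s).1) (i-1/2) k : ℤ) - (Aj (fun s => (l s).1) (i+1/2) k : ℤ))) + 1)
        * qint (Aj (fun s => (l s).1) (i+1/2) (-((r : ℚ) + 1)))) •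
        tP (Xij m n n) (matMove (Aj fun s => (l s).1) (i-1/2) (-((r : ℚ) + 1))
          (i+1/2) (-((r : ℚ) + 1))) := by
  have hm : matMove (Aj fun s => (l s).1) (-i+1/2) ((r : ℚ) + 1) (-i-1/2) ((r : ℚ) + 1)
      = matMove (Aj fun s => (l s).1) (i-1/2) (-((r : ℚ) + 1)) (i+1/2) (-((r : ℚ) + 1)) := by
    funext x y
    simp only [matMove]
    rw [← chiM_neg (i-1/2), ← chiM_neg (i+1/2), neg_neg, neg_sub', neg_add', sub_neg_eq_add]
  have hA (y : ℚ) : Aj (fun s => (l s).1) (-i+1/2) y = Aj (fun s => (l s).1) (i-1/2) (-y) := by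
    rw [← Aj_neg, neg_add', neg_neg]
  have hA' (y : ℚ) : Aj (fun s => (l s).1) (-i-1/2) y = Aj (fun s => (l s).1) (i+1/2) (-y) := by
    rw [← Aj_neg, neg_sub', neg_neg, sub_neg_eq_add]
  rw [Lamj_F_term, hm, sum_II_odd_ge_pos, sum_II_odd_le_neg]
  simp only [hA, hA']

theorem Lamj_E_neg_term {i : ℚ} (hi : 0 < i) (l : Fin n → SubI (2*m+1)) (r : Fin n) :
    Lamj m n (tensorOp (fun s => if s < r then kinv i else if s = r then
        (Eop (-i)).comp (Kinv i) else Kinv i) (tT l)) =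
      (q ^ ((∑ k ∈ (II (2*n+1)).filter (fun k => -((r : ℚ) + 1) ≤ k),
          ((Aj (fun s => (l s).1) (i+1/2) k : ℤ) - (Aj (fun s => (l s).1) (i-1/2) k : ℤ))) + 1
          + (if i = 1/2 then 1 else 0))
        * qint (Aj (fun s => (l s).1) (i-1/2) (-((r : ℚ) + 1)))) •
        tP (Xij m n n) (matMove (Aj fun s => (l s).1) (i+1/2) (-((r : ℚ) + 1))
          (i-1/2) (-((r : ℚ) + 1))) := by
  set L : Fin n → ℚ := fun s => (l s).1 with hL
  let g : ℚ → ℤ := fun k => (Aj L (i+1/2) k : ℤ) - (Aj L (i-1/2) k : ℤ)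
  by_cases hr : i - 1/2 = -L r
  · have hrL : (l r).1 = -i + 1/2 := by
      change L r = _
      linarith
    rw [Lamj_tensorOp_tT_of_zpow (r := r) (p := -(i + 1/2))
      (e := fun s : Fin n => g ((s : ℚ) + 1) + if s < r then g (-((s : ℚ) + 1)) else 0)]
    · have h0 : g 0 + (if i = 1/2 then 1 else 0) = 0 := by
        simp only [g, Aj_apply_zero, sub_eq_zero]
        rw [if_neg (by linarith : ¬ i + 1/2 = 0)]
        split_ifs <;> simp
      rw [Aj_apply_neg, if_pos hr, Nat.cast_one, qint_one, mul_one, sum_II_odd_ge_neg,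
        show ∀ x y z w : ℤ, x + y + z + w = y + z + (x + w) from fun _ _ _ _ => by ring, h0,
        add_zero, sum_add_eq_sum_of_ne r (g := fun s : Fin n => g ((s : ℚ) + 1) +
          if s < r then g (-((s : ℚ) + 1)) else 0)]
      · conv_rhs => rw [← neg_neg (i + 1/2), hr, matMove_Aj_neg]
      · intro s hs
        simp only [hs.le_iff_lt, g]
      · rw [if_pos le_rfl, if_neg (lt_irrefl r), Aj_apply_neg, Aj_apply_neg, if_pos hr,
          if_neg (by linarith)]
        simp only [g]
        push_cast
        ring
    · intro s
      rcases lt_trichotomy s r with h | rfl | h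
      · rw [if_pos h, if_pos h]
        exact kinv_c_eq L i s
      · simp only [lt_irrefl, if_true, if_false, add_zero]
        rw [SOp.comp_c]
        change _ * (Eop (-i)).c (l s).1 = _
        rw [Eop_c_self hrL, mul_one]
        exact Kinv_c_eq L i s
      · rw [if_neg h.not_gt, if_neg h.ne', if_neg h.not_gt, add_zero]
        exact Kinv_c_eq L i s
    · simp only [lt_irrefl, if_true, if_false]
      change (l r).1 - 1 = _
      rw [hrL]
      ring
    · intro s hs
      rcases hs.lt_or_gt with h | h
      · rw [if_pos h]
        rfl
      · rw [if_neg h.not_gt, if_neg h.ne']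
        rfl
  · rw [Lamj_tensorOp_tT_of_zero r, Aj_apply_neg, if_neg hr, Nat.cast_zero, qint_zero, mul_zero,
      zero_smul]
    simp only [lt_irrefl, if_true, if_false]
    rw [SOp.comp_c, Eop_c_of_ne, mul_zero]
    intro h
    change L r = _ at h
    exact hr (by linarith)

theorem Lamj_E_term {i : ℚ} (hi : 0 < i) (l : Fin n → SubI (2*m+1)) (r : Fin n) :
    Lamj m n (tensorOp (fun s => if s < r then kpos i else if s = r then
        (Kinv (-i)).comp (Eop i) else Kinv (-i)) (tT l)) =
      (q ^ ((∑ k ∈ (II (2*n+1)).filter (fun k => k ≤ (r : ℚ) + 1),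
          ((Aj (fun s => (l s).1) (i-1/2) k : ℤ) - (Aj (fun s => (l s).1) (i+1/2) k : ℤ))) + 1)
        * qint (Aj (fun s => (l s).1) (i+1/2) ((r : ℚ) + 1))) •
        tP (Xij m n n) (matMove (Aj fun s => (l s).1) (i-1/2) ((r : ℚ) + 1)
          (i+1/2) ((r : ℚ) + 1)) := by
  set L : Fin n → ℚ := fun s => (l s).1 with hL
  let g : ℚ → ℤ := fun k => (Aj L (i-1/2) k : ℤ) - (Aj L (i+1/2) k : ℤ)
  by_cases hr : i + 1/2 = L r
  · have hrL : (l r).1 = i + 1/2 := hr.symm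
    rw [Lamj_tensorOp_tT_of_zpow (r := r) (p := i - 1/2)
      (e := fun s : Fin n => (if s < r then g ((s : ℚ) + 1) else 0) + if s = r then g 0 else
        g (-((s : ℚ) + 1)))]
    · rw [Aj_apply_pos, if_pos hr, Nat.cast_one, qint_one, mul_one, sum_II_odd_le_pos,
        show ∀ x y z : ℤ, x + y + z = y + (x + z) from fun _ _ _ => by ring,
        sum_add_eq_sum_of_ne r (g := fun s : Fin n => (if s < r then g ((s : ℚ) + 1) else 0) +
          if s = r then g 0 else g (-((s : ℚ) + 1)))]
      · rw [hr, matMove_Aj_pos]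
      · intro s hs
        simp only [hs.le_iff_lt, hs, if_false, g]
      · rw [if_pos le_rfl, if_neg (lt_irrefl r), if_pos rfl, Aj_apply_pos, Aj_apply_pos, if_pos hr,
          if_neg (by linarith), Aj_apply_neg, Aj_apply_neg, if_neg (by linarith),
          if_neg (by linarith)]
        simp only [g]
        push_cast
        ring
    · intro s
      rcases lt_trichotomy s r with h | rfl | h
      · rw [if_pos h, if_pos h, if_neg h.ne]
        exact kpos_c_eq L i s
      · simp only [lt_irrefl, if_true, if_false, zero_add]
        rw [SOp.comp_c, Eop_c_self hrL, one_mul]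
        change (Kinv (-i)).c ((l s).1 - 1) = _
        simp only [hrL, Kinv, diagOp, g, Aj_apply_zero]
        congr 1
        rw [if_neg (by linarith : ¬ i + 1/2 = 0), if_neg (by linarith : ¬ i + 1/2 - 1 = -i - 1/2)]
        by_cases h : i = 1/2
        · subst h
          norm_num
        · rw [if_neg fun e => h (by linarith), if_neg fun e => h (by linarith)]
          simp
      · rw [if_neg h.not_gt, if_neg h.ne', if_neg h.not_gt, if_neg h.ne', zero_add]
        exact Kinv_neg_c_eq L i s
    · simp only [lt_irrefl, if_true, if_false]
      change (l r).1 - 1 = _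
      rw [hrL]
      ring
    · intro s hs
      rcases hs.lt_or_gt with h | h
      · rw [if_pos h]
        rfl
      · rw [if_neg h.not_gt, if_neg h.ne']
        rfl
  · rw [Lamj_tensorOp_tT_of_zero r, Aj_apply_pos, if_neg hr, Nat.cast_zero, qint_zero, mul_zero,
      zero_smul]
    simp only [lt_irrefl, if_true, if_false]
    rw [SOp.comp_c, Eop_c_of_ne fun h => hr h.symm, zero_mul]

theorem Lamj_calB {i : ℚ} (hi : 0 < i) (v : TV n (2*m+1)) :
    Lamj m n (calB n (2*m+1) i v) = BLj n (Xij m n n) i (Lamj m n v) := by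
  refine linearMap_eq_of_tT (f := Lamj m n ∘ₗ calB n (2*m+1) i)
    (g := BLj n (Xij m n n) i ∘ₗ Lamj m n) (fun l => ?_) v
  rw [LinearMap.comp_apply, LinearMap.comp_apply, Lamj_tT, BLj,
    opOf_tP _ (Aj_mem_Xij fun r => (l r).2), calB, LinearMap.add_apply, LinearMap.sum_apply,
    LinearMap.sum_apply, map_add, map_sum, map_sum, sum_II_odd_nonpos, sum_II_odd_pos, add_comm]
  have h0 : ¬ (if i = 1/2 ∧ (0 : ℚ) = 0 then 1 else 0) < Aj (fun r => (l r).1) (i - 1/2) 0 := by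
    rw [Aj_apply_zero]
    simp only [sub_eq_zero, and_true, lt_irrefl, not_false_eq_true]
  rw [if_neg h0, zero_add]
  simp only [Lamj_F_term, Lamj_E_neg_term hi]
  congr 1
  refine Finset.sum_congr rfl fun r _ => ?_
  have h : ¬ (i = 1/2 ∧ -((r : ℚ) + 1) = 0) := fun e =>
    (Fin.cast_add_one_pos r).ne' (neg_eq_zero.1 e.2)
  rw [if_neg h, if_neg h, sub_zero]
  by_cases h1 : 0 < Aj (fun r => (l r).1) (i - 1/2) (-((r : ℚ) + 1))
  · rw [if_pos h1]
  · rw [if_neg h1, Nat.eq_zero_of_not_pos h1, Nat.cast_zero, qint_zero, mul_zero, zero_smul]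

theorem Lamj_calBn {i : ℚ} (hi : 0 < i) (v : TV n (2*m+1)) :
    Lamj m n (calBn n (2*m+1) i v) = BLjn n (Xij m n n) i (Lamj m n v) := by
  refine linearMap_eq_of_tT (f := Lamj m n ∘ₗ calBn n (2*m+1) i)
    (g := BLjn n (Xij m n n) i ∘ₗ Lamj m n) (fun l => ?_) v
  rw [LinearMap.comp_apply, LinearMap.comp_apply, Lamj_tT, BLjn,
    opOf_tP _ (Aj_mem_Xij fun r => (l r).2), calBn, LinearMap.add_apply, LinearMap.sum_apply,
    LinearMap.sum_apply, map_add, map_sum, map_sum, sum_II_odd, Finset.sum_add_distrib, add_comm]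
  simp only [Lamj_F_neg_term, Lamj_E_term hi]
  rw [Aj_apply_zero, if_neg (by linarith : ¬ i + 1/2 = 0), Nat.cast_zero, qint_zero, mul_zero,
    zero_smul, zero_add]

theorem Lamj_diag {D : SOp} {f : Mat → ℤ} (ht : ∀ a, D.t a = a)
    (hc : ∀ l : Fin n → ℚ, ∏ r, D.c (l r) = q ^ f (Aj l)) (v : TV n (2*m+1)) :
    Lamj m n (tensorOp (fun _ => D) v) =
      opOf (fun A => q ^ f A • tP (Xij m n n) A) (Lamj m n v) := by
  refine linearMap_eq_of_tT (f := Lamj m n ∘ₗ tensorOp fun _ => D)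
    (g := opOf (fun A => q ^ f A • tP (Xij m n n) A) ∘ₗ Lamj m n) (fun l => ?_) v
  rw [LinearMap.comp_apply, LinearMap.comp_apply, Lamj_tT,
    opOf_tP _ (Aj_mem_Xij fun r => (l r).2), Lamj_tensorOp_tT, hc fun r => (l r).1]
  simp only [ht]

theorem Lamj_calD0 (v : TV n (2*m+1)) :
    Lamj m n (calD0 n (2*m+1) 1 v) = dL0j n (Xij m n n) 1 (Lamj m n v) := by
  refine Lamj_diag (D := D0op 1)
    (f := fun A => 1 * (((∑ j ∈ II (2*n+1), (A 0 j : ℤ)) - 1) / 2)) (fun _ => rfl) (fun l => ?_) v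
  simp only [D0op, diagOp, one_mul, ← q_zpow_sum]
  congr 1
  rw [sum_II_odd]
  simp only [Aj_apply_zero, Aj_apply_pos, Aj_apply_neg, if_true, neg_eq_zero, eq_comm (a := (0 : ℚ)),
    Nat.cast_ite, Nat.cast_one, Nat.cast_zero, Finset.sum_add_distrib]
  omega

theorem Lamj_calD {r : ℚ} (hr : 0 < r) (v : TV n (2*m+1)) :
    Lamj m n (calD n (2*m+1) r 1 v) = dLj n (Xij m n n) r 1 (Lamj m n v) := by
  refine Lamj_diag (D := DDop r 1)
    (f := fun A => 1 * ∑ j ∈ II (2*n+1), (A r j : ℤ)) (fun _ => rfl) (fun l => ?_) v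
  simp only [DDop, diagOp, one_mul, ← q_zpow_sum]
  congr 1
  rw [sum_II_odd]
  simp only [Aj_apply_zero, Aj_apply_pos, Aj_apply_neg, if_neg hr.ne', Nat.cast_ite, Nat.cast_one,
    Nat.cast_zero, zero_add]
  refine Finset.sum_congr rfl fun s _ => ?_
  simp only [eq_comm (a := r), neg_eq_iff_eq_neg]

end Intertwining

theorem stmt1 (m n : ℕ) (hm : 1 ≤ m) (hn : 1 ≤ n) :
    -- (1) invariance of 𝒱^{ȷ,0}_{m|n,n} under the left action
    (∀ i ∈ II (2*m), 0 < i → ∀ v ∈ V0j m n,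
        BLj n (Xij m n n) i v ∈ V0j m n ∧ BLjn n (Xij m n n) i v ∈ V0j m n) ∧
    (∀ v ∈ V0j m n, dL0j n (Xij m n n) 1 v ∈ V0j m n) ∧
    (∀ r ∈ II (2*m+1), 0 < r → ∀ v ∈ V0j m n, dLj n (Xij m n n) r 1 v ∈ V0j m n) ∧
    -- (2) Λ^ȷ is a bijection from V^{⊗n} onto 𝒱^{ȷ,0}_{m|n,n}
    (Function.Injective ⇑(Lamj m n) ∧ Set.range ⇑(Lamj m n) = ↑(V0j m n)) ∧
    -- (3) Λ^ȷ intertwines the two actions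
    (∀ i ∈ II (2*m), 0 < i → ∀ v : TV n (2*m+1),
        Lamj m n (calB n (2*m+1) i v) = BLj n (Xij m n n) i (Lamj m n v)
      ∧ Lamj m n (calBn n (2*m+1) i v) = BLjn n (Xij m n n) i (Lamj m n v)) ∧
    (∀ v : TV n (2*m+1), Lamj m n (calD0 n (2*m+1) 1 v) = dL0j n (Xij m n n) 1 (Lamj m n v)) ∧
    (∀ r ∈ II (2*m+1), 0 < r → ∀ v : TV n (2*m+1),
        Lamj m n (calD n (2*m+1) r 1 v) = dLj n (Xij m n n) r 1 (Lamj m n v)) := by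
  refine ⟨fun i _ hi v hv => ⟨map_mem_V0j_of_intertwines (Lamj_calB hi) hv,
      map_mem_V0j_of_intertwines (Lamj_calBn hi) hv⟩,
    fun v hv => map_mem_V0j_of_intertwines Lamj_calD0 hv,
    fun r _ hr v hv => map_mem_V0j_of_intertwines (Lamj_calD hr) hv,
    ⟨Lamj_injective, ?_⟩, fun i _ hi v => ⟨Lamj_calB hi v, Lamj_calBn hi v⟩, Lamj_calD0,
    fun r _ hr v => Lamj_calD hr v⟩
  rw [← range_Lamj, LinearMap.coe_range]

end
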